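/- arXiv:2304.05598 — 3 statements merged into one kernel-verified Lean document; each statement's English description precedes it below -/
import Mathlib

section
/- For every e ∈ {0,…,q−1}^t and every x ∈ F_q^{s+t} with H_e(x) ≠ 0, each block (x_{p(i−1)+1}, …, x_{pi}) for 1 ≤ i ≤ s/p lies in supp(P) = {y ∈ F_q^p : P(y) ≠ 0}. Consequently, |supp(H)| ≤ ((2^{p−1} + p − 1)·q^{p−1})^{s/p} · q^t ≤ (3q)^{s(p−1)/p} · q^t. -/
noncomputable section

open Finset

/-- Affine maps `F^ℓ → F^n`, given as a pair (linear part matrix, translation). -/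
abbrev Aff (F : Type) (n ℓ : ℕ) := Matrix (Fin n) (Fin ℓ) F × (Fin n → F)

/-- Application of an affine map `T = (M, c)`: `x ↦ Mx + c`. -/
def affApp {F : Type} [Field F] {n ℓ : ℕ} (T : Aff F n ℓ) (x : Fin ℓ → F) : Fin n → F :=
  T.1.mulVec x + T.2

/-- Inner product of two functions `F^m → F`. -/
def ip {F : Type} [Field F] [Fintype F] {m : ℕ} (u v : (Fin m → F) → F) : F :=
  ∑ z : Fin m → F, u z * v z

/-- `g` has degree at most `d` as a function. -/
def fDegLE {F : Type} [Field F] {m : ℕ} (g : (Fin m → F) → F) (d : ℕ) : Prop :=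
  ∃ Q : MvPolynomial (Fin m) F, Q.totalDegree ≤ d ∧ ∀ x, MvPolynomial.eval x Q = g x

/-- The defining equation of the polynomial `P`:
`x_1 ⋯ x_{p-1} · P = ∑_{I ⊆ [p-1]} (-1)^{|I|+1} (x_I + x_p)^{q-1}`. -/
def Pdef {F : Type} [Field F] (p q : ℕ) (hp : 0 < p) (P : MvPolynomial (Fin p) F) : Prop :=
  (∏ i : Fin (p - 1), MvPolynomial.X (Fin.castLE (Nat.sub_le p 1) i)) * P =
    ∑ I : Finset (Fin (p - 1)),
      MvPolynomial.C ((-1 : F) ^ (I.card + 1)) *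
        ((∑ i ∈ I, MvPolynomial.X (Fin.castLE (Nat.sub_le p 1) i)) +
          MvPolynomial.X (⟨p - 1, Nat.sub_lt hp one_pos⟩ : Fin p)) ^ (q - 1)

/-- The test polynomial `H_e` as a function on `F^{s+t}`. -/
def Hfun {F : Type} [Field F] {p : ℕ} (P : MvPolynomial (Fin p) F)
    (s t : ℕ) (e : Fin t → ℕ) (x : Fin (s + t) → F) : F :=
  (∏ i ∈ Finset.range (s / p),
    MvPolynomial.eval (fun l : Fin p =>
      if h : p * i + (l : ℕ) < s + t then x ⟨p * i + (l : ℕ), h⟩ else 0) P) *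
  ∏ j : Fin t, x (Fin.natAdd s j) ^ e j

/-- A degree sequence `e ∈ {0, …, q-1}^t` is valid if `∑ e_j ≤ t(q-1) - r`. -/
def validE (q r t : ℕ) (e : Fin t → ℕ) : Prop :=
  (∀ j, e j ≤ q - 1) ∧ ∑ j, e j ≤ t * (q - 1) - r

/-- `T` rejects `f` in the sparse `(s+t)`-flat test. -/
def rejects {F : Type} [Field F] [Fintype F] {p : ℕ} (P : MvPolynomial (Fin p) F)
    (q s r t n : ℕ) (f : (Fin n → F) → F) (T : Aff F n (s + t)) : Prop :=
  ∃ e : Fin t → ℕ, validE q r t e ∧ ip (fun x => f (affApp T x)) (Hfun P s t e) ≠ 0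

/-- Density of `A` inside `C`. -/
def dens {α : Type} (A C : Set α) : ℝ :=
  (Nat.card ↥(A ∩ C) : ℝ) / (Nat.card ↥C : ℝ)

/-- Fractional measure of a set in a (finite) type. -/
def mu {α : Type} (A : Set α) : ℝ :=
  (Nat.card ↥A : ℝ) / (Nat.card α : ℝ)

/-- The union of the supports of the test polynomials `H_e`. -/
def suppH {F : Type} [Field F] [Fintype F] {p : ℕ} (P : MvPolynomial (Fin p) F)
    (q s t : ℕ) : Set (Fin (s + t) → F) :=
  {x | ∃ e : Fin t → ℕ, (∀ j, e j ≤ q - 1) ∧ Hfun P s t e x ≠ 0}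

/-- Edge expansion of a set `S` in the (regular) graph with adjacency `adj`:
the probability that a uniformly random step started in `S` escapes `S`. -/
def expans {α : Type} (adj : α → α → Prop) (S : Set α) : ℝ :=
  (Nat.card {x : α × α // x.1 ∈ S ∧ adj x.1 x.2 ∧ x.2 ∉ S} : ℝ) /
  (Nat.card {x : α × α // x.1 ∈ S ∧ adj x.1 x.2} : ℝ)

/-- Adjacency in the affine bi-linear scheme graph: two distinct affine maps are adjacent
iff their agreement set is an affine subspace of dimension `ℓ - 1`. -/
def adjBilin {F : Type} [Field F] {n ℓ : ℕ} (T₁ T₂ : Aff F n ℓ) : Prop :=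
  T₁ ≠ T₂ ∧ ∃ W : AffineSubspace F (Fin ℓ → F),
    (W : Set (Fin ℓ → F)).Nonempty ∧
    (W : Set (Fin ℓ → F)) = {x | affApp T₁ x = affApp T₂ x} ∧
    Module.finrank F W.direction = ℓ - 1

/-- `W` is an `ℓ`-flat: a nonempty affine subspace of dimension `ℓ`. -/
def IsFlat {F : Type} [Field F] {N : ℕ} (ℓ : ℕ) (W : AffineSubspace F (Fin N → F)) : Prop :=
  (W : Set (Fin N → F)).Nonempty ∧ Module.finrank F W.direction = ℓ

/-- Adjacency in the affine Grassmann graph `AffGras(N, ℓ)`: two distinct `ℓ`-flats are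
adjacent iff their intersection is an `(ℓ-1)`-flat. -/
def adjGras {F : Type} [Field F] {N : ℕ} (ℓ : ℕ) (U V : AffineSubspace F (Fin N → F)) : Prop :=
  U ≠ V ∧ IsFlat ℓ U ∧ IsFlat ℓ V ∧ IsFlat (ℓ - 1) (U ⊓ V)

/-- The minimal fractional Hamming distance from `f` to a function of degree at most `d`. -/
def deltaDist {F : Type} [Field F] [Fintype F] {n : ℕ} (f : (Fin n → F) → F) (d : ℕ) : ℝ :=
  sInf {x : ℝ | ∃ g : (Fin n → F) → F, fDegLE g d ∧
    x = (Nat.card {y : Fin n → F // f y ≠ g y} : ℝ) / (Fintype.card (Fin n → F) : ℝ)}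

/-- A point in the support of `P` has a vanishing coordinate among the first `p - 1`, or its last
coordinate is minus a subset sum of the others. -/
lemma exists_of_eval_ne_zero {F : Type} [Field F] [Fintype F] {p q : ℕ} (hp : p.Prime)
    (hcard : Fintype.card F = q) {P : MvPolynomial (Fin p) F} (hP : Pdef p q hp.pos P)
    {y : Fin p → F} (hy : MvPolynomial.eval y P ≠ 0) :
    (∃ i : Fin (p - 1), y (Fin.castLE (Nat.sub_le p 1) i) = 0) ∨
      ∃ I : Finset (Fin (p - 1)),
        y ⟨p - 1, Nat.sub_lt hp.pos one_pos⟩ = -∑ i ∈ I, y (Fin.castLE (Nat.sub_le p 1) i) := by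
  by_contra! h
  obtain ⟨h0, hI⟩ := h
  have key := congrArg (MvPolynomial.eval y) hP
  simp only [map_mul, map_prod, map_sum, map_pow, map_add, MvPolynomial.eval_X,
    MvPolynomial.eval_C] at key
  have hpow (I : Finset (Fin (p - 1))) :
      ((∑ i ∈ I, y (Fin.castLE (Nat.sub_le p 1) i)) +
        y ⟨p - 1, Nat.sub_lt hp.pos one_pos⟩) ^ (q - 1) = 1 := by
    rw [← hcard]
    refine FiniteField.pow_card_sub_one_eq_one _ fun h => hI I ?_
    exact eq_neg_of_add_eq_zero_right h
  have hsum : ∑ I : Finset (Fin (p - 1)), (-1 : F) ^ (I.card + 1) = 0 := by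
    have hne : (Finset.univ : Finset (Fin (p - 1))).Nonempty :=
      ⟨⟨0, Nat.sub_pos_of_lt hp.one_lt⟩, Finset.mem_univ _⟩
    have h := congrArg (Int.cast : ℤ → F) (Finset.sum_powerset_neg_one_pow_card_of_nonempty hne)
    rw [Finset.powerset_univ] at h
    push_cast at h
    simp only [pow_succ, ← Finset.sum_mul, h, zero_mul]
  simp only [hpow, mul_one, hsum] at key
  exact (mul_ne_zero (Finset.prod_ne_zero_iff.mpr fun i _ => h0 i) hy) key

/-- The graph `{y | y j = g (y restricted to the other coordinates)}` has at most
`|F| ^ (|ι| - 1)` points. -/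
lemma ncard_setOf_eq_le {F ι : Type} [Fintype F] [Fintype ι] [DecidableEq ι] (j : ι)
    (g : ({i : ι // i ≠ j} → F) → F) :
    {y : ι → F | y j = g fun i => y i}.ncard ≤ Fintype.card F ^ (Fintype.card ι - 1) := by
  have hinj : Set.InjOn (fun (y : ι → F) (i : {i : ι // i ≠ j}) => y i)
      {y : ι → F | y j = g fun i => y i} := by
    intro y hy z hz hyz
    funext i
    by_cases hi : i = j
    · subst hi
      exact hy.trans ((congrArg g hyz).trans hz.symm)
    · exact congrFun hyz ⟨i, hi⟩
  refine (Set.ncard_le_ncard_of_injOn _ (t := Set.univ) (fun _ _ => Set.mem_univ _) hinj).trans ?_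
  rw [Set.ncard_univ, Nat.card_eq_fintype_card, Fintype.card_fun, Fintype.card_subtype_compl,
    Fintype.card_subtype_eq]

/-- Bound on the size of the support of `P`. -/
lemma ncard_eval_ne_zero_le {F : Type} [Field F] [Fintype F] {p q : ℕ} (hp : p.Prime)
    (hcard : Fintype.card F = q) {P : MvPolynomial (Fin p) F} (hP : Pdef p q hp.pos P) :
    {y : Fin p → F | MvPolynomial.eval y P ≠ 0}.ncard ≤
      (2 ^ (p - 1) + p - 1) * q ^ (p - 1) := by
  set last : Fin p := ⟨p - 1, Nat.sub_lt hp.pos one_pos⟩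
  have hne (i : Fin (p - 1)) : Fin.castLE (Nat.sub_le p 1) i ≠ last := fun h =>
    i.2.ne (congrArg Fin.val h)
  let A (i : Fin (p - 1)) : Set (Fin p → F) := {y | y (Fin.castLE (Nat.sub_le p 1) i) = 0}
  let B (I : Finset (Fin (p - 1))) : Set (Fin p → F) :=
    {y | y last = -∑ i ∈ I, y (Fin.castLE (Nat.sub_le p 1) i)}
  have hA (i : Fin (p - 1)) : (A i).ncard ≤ q ^ (p - 1) := by
    simpa [hcard] using ncard_setOf_eq_le (F := F) (Fin.castLE (Nat.sub_le p 1) i) fun _ => 0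
  have hB (I : Finset (Fin (p - 1))) : (B I).ncard ≤ q ^ (p - 1) := by
    simpa [hcard] using ncard_setOf_eq_le (F := F) last
      fun z => -∑ i ∈ I, z ⟨Fin.castLE (Nat.sub_le p 1) i, hne i⟩
  have hsub : {y : Fin p → F | MvPolynomial.eval y P ≠ 0} ⊆ (⋃ i, A i) ∪ ⋃ I, B I := by
    intro y hy
    rcases exists_of_eval_ne_zero hp hcard hP hy with ⟨i, hi⟩ | ⟨I, hI⟩
    · exact Or.inl (Set.mem_iUnion.mpr ⟨i, hi⟩)
    · exact Or.inr (Set.mem_iUnion.mpr ⟨I, hI⟩)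
  calc {y : Fin p → F | MvPolynomial.eval y P ≠ 0}.ncard
      ≤ ((⋃ i, A i) ∪ ⋃ I, B I).ncard := Set.ncard_le_ncard hsub
    _ ≤ (⋃ i, A i).ncard + (⋃ I, B I).ncard := Set.ncard_union_le _ _
    _ ≤ ∑ i, (A i).ncard + ∑ I, (B I).ncard :=
        add_le_add (Set.ncard_iUnion_le_of_fintype A) (Set.ncard_iUnion_le_of_fintype B)
    _ ≤ ∑ _i : Fin (p - 1), q ^ (p - 1) + ∑ _I : Finset (Fin (p - 1)), q ^ (p - 1) :=
        add_le_add (Finset.sum_le_sum fun i _ => hA i) (Finset.sum_le_sum fun I _ => hB I)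
    _ = (2 ^ (p - 1) + p - 1) * q ^ (p - 1) := by
        rw [Nat.add_sub_assoc hp.one_le]
        simp only [Finset.sum_const, Finset.card_univ, Fintype.card_fin, Fintype.card_finset,
          smul_eq_mul]
        ring

/-- If every length-`p` block among the first `p * a` coordinates of the points of `S` lies in `V`,
then `S` has at most `|V| ^ a * |F| ^ t` points. -/
lemma ncard_le_of_blocks_mem {F : Type} [Zero F] [Fintype F] {p a t : ℕ} (hp : 0 < p)
    (V : Set (Fin p → F)) (S : Set (Fin (p * a + t) → F))
    (hS : ∀ x ∈ S, ∀ i < a,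
      (fun l : Fin p => if h : p * i + (l : ℕ) < p * a + t then x ⟨p * i + (l : ℕ), h⟩ else 0) ∈ V) :
    S.ncard ≤ V.ncard ^ a * Fintype.card F ^ t := by
  let f : S → (Fin a → V) × (Fin t → F) := fun x =>
    (fun i => ⟨_, hS x.1 x.2 i i.2⟩, fun j => x.1 (Fin.natAdd (p * a) j))
  have hf : Function.Injective f := by
    rintro ⟨x, hx⟩ ⟨y, hy⟩ hxy
    have h1 := congrArg Prod.fst hxy
    have h2 := congrArg Prod.snd hxy
    refine Subtype.ext (funext fun j => ?_)
    by_cases hj : (j : ℕ) < p * a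
    · have hdiv : (j : ℕ) / p < a := Nat.div_lt_of_lt_mul hj
      have h := congrFun (congrArg Subtype.val (congrFun h1 ⟨j / p, hdiv⟩))
        ⟨j % p, Nat.mod_lt _ hp⟩
      simpa only [f, Nat.div_add_mod, j.2, dite_true] using h
    · have hlt : (j : ℕ) - p * a < t := by omega
      have hj' : Fin.natAdd (p * a) ⟨j - p * a, hlt⟩ = j := Fin.ext (by simp; omega)
      simpa only [f, hj'] using congrFun h2 ⟨j - p * a, hlt⟩
  have h := Nat.card_le_card_of_injective f hf
  rw [Nat.card_prod, Nat.card_fun, Nat.card_fun, Nat.card_coe_set_eq, Nat.card_coe_set_eq] at h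
  simpa only [Nat.card_eq_fintype_card, Fintype.card_fin] using h

lemma two_pow_add_self_le_three_pow {m : ℕ} (hm : 1 ≤ m) : 2 ^ m + m ≤ 3 ^ m := by
  induction m, hm using Nat.le_induction with
  | base => norm_num
  | succ n hn ih =>
    rw [pow_succ, pow_succ]
    omega

/-- If `H_e(x) ≠ 0` then every block `(x_{p(i-1)+1}, …, x_{pi})` lies in the
support of `P`; consequently `|supp(H)| ≤ ((2^{p-1}+p-1)·q^{p-1})^{s/p} · q^t ≤ (3q)^{s(p-1)/p} · q^t`. -/
theorem support_of_H
    (p k : ℕ) (hp : p.Prime) (hk : 1 ≤ k)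
    (F : Type) [Field F] [Fintype F]
    (q : ℕ) (hq : q = p ^ k) (hcard : Fintype.card F = q)
    (d s r : ℕ) (hsp : p ∣ s) (hr0 : 0 < r) (hr1 : r ≤ p * (q - q / p))
    (hd : d + 1 = s * (q - q / p) + r)
    (t : ℕ) (ht : t = max (p + 2) 10)
    (P : MvPolynomial (Fin p) F) (hP : Pdef p q hp.pos P) :
    (∀ e : Fin t → ℕ, (∀ j, e j ≤ q - 1) → ∀ x : Fin (s + t) → F, Hfun P s t e x ≠ 0 →
      ∀ i : ℕ, i < s / p →
        MvPolynomial.eval (fun l : Fin p =>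
          if h : p * i + (l : ℕ) < s + t then x ⟨p * i + (l : ℕ), h⟩ else 0) P ≠ 0) ∧
    (suppH P q s t).ncard ≤ ((2 ^ (p - 1) + p - 1) * q ^ (p - 1)) ^ (s / p) * q ^ t ∧
    ((2 ^ (p - 1) + p - 1) * q ^ (p - 1)) ^ (s / p) * q ^ t ≤
      (3 * q) ^ (s * (p - 1) / p) * q ^ t := by
  have hblock : ∀ e : Fin t → ℕ, ∀ x : Fin (s + t) → F, Hfun P s t e x ≠ 0 →
      ∀ i : ℕ, i < s / p →
        MvPolynomial.eval (fun l : Fin p =>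
          if h : p * i + (l : ℕ) < s + t then x ⟨p * i + (l : ℕ), h⟩ else 0) P ≠ 0 :=
    fun e x hx i hi =>
      Finset.prod_ne_zero_iff.mp (left_ne_zero_of_mul hx) i (Finset.mem_range.mpr hi)
  refine ⟨fun e _ => hblock e, ?_, ?_⟩
  · obtain ⟨a, rfl⟩ := hsp
    rw [Nat.mul_div_cancel_left a hp.pos] at hblock ⊢
    refine (ncard_le_of_blocks_mem hp.pos {y | MvPolynomial.eval y P ≠ 0} _ ?_).trans ?_
    · rintro x ⟨e, -, hx⟩ i hi
      exact hblock e x hx i hi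
    · rw [hcard]
      gcongr
      exact ncard_eval_ne_zero_le hp hcard hP
  · obtain ⟨a, rfl⟩ := hsp
    rw [Nat.mul_div_cancel_left a hp.pos, mul_assoc, Nat.mul_div_cancel_left _ hp.pos,
      mul_comm a, pow_mul, mul_pow 3 q, Nat.add_sub_assoc hp.one_le]
    gcongr
    exact two_pow_add_self_le_three_pow (Nat.sub_pos_of_lt hp.one_lt)

end
end

section
/- Let e ∈ {0,…,q−1}^t and e' ∈ {0,…,q−1}^{s+t}. If ⟨x^{e'}, H_e⟩ = Σ_{x ∈ F_q^{s+t}} (Π_{i=1}^{s+t} x_i^{e'_i}) · H_e(x) ≠ 0, then: (i) for every 1 ≤ i ≤ s/p, e'_{p(i−1)+1} + ⋯ + e'_{pi} = p·(q − q/p); and (ii) for every 1 ≤ j ≤ t, e'_{s+j} + e_j ∈ {q−1, 2(q−1)}. -/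
noncomputable section

open Finset

/-- A monomial sum over a finite field is nonzero only if every exponent is a positive
multiple of `|F| - 1`. -/
theorem pos_and_card_sub_one_dvd_of_sum_prod_pow_ne_zero {F ι : Type*} [Field F] [Fintype F]
    [Fintype ι] [DecidableEq ι] (E : ι → ℕ) (h : ∑ z : ι → F, ∏ k, z k ^ E k ≠ 0) (k : ι) :
    0 < E k ∧ (Fintype.card F - 1) ∣ E k := by
  classical
  have hprod : ∑ z : ι → F, ∏ k, z k ^ E k = ∏ k, ∑ a : F, a ^ E k := by
    rw [Finset.prod_univ_sum, Fintype.piFinset_univ]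
  rw [hprod, Finset.prod_ne_zero_iff] at h
  have hk := h k (Finset.mem_univ k)
  have hpos : 0 < E k := by
    rcases Nat.eq_zero_or_pos (E k) with h0 | h0
    · simp [h0] at hk
    · exact h0
  refine ⟨hpos, ?_⟩
  by_contra hdvd
  apply hk
  rw [← Fintype.sum_subtype_add_sum_subtype (fun a : F => a ≠ 0)]
  have h1 : ∑ a : {a : F // a ≠ 0}, (a : F) ^ E k = 0 := by
    rw [← Equiv.sum_comp unitsEquivNeZero]
    simpa [hdvd] using FiniteField.sum_pow_units F (E k)
  rw [h1, zero_add]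
  refine Finset.sum_eq_zero fun a _ => ?_
  rw [not_not.mp a.2, zero_pow hpos.ne']

/-- If the sum of a product of sums is nonzero, then so is the part of it coming from some
choice of one summand in each factor. -/
theorem exists_choice_sum_ne_zero {F ι κ σ : Type*} [Field F] [Fintype ι] [DecidableEq ι]
    [Fintype σ] (S : Finset κ) (a : κ → F) (g : ι → κ → σ → F) (u w : σ → F)
    (h : ∑ z, u z * ((∏ i, ∑ d ∈ S, a d * g i d z) * w z) ≠ 0) :
    ∃ c : ι → κ, (∀ i, c i ∈ S) ∧ ∑ z, u z * ((∏ i, g i (c i) z) * w z) ≠ 0 := by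
  by_contra! hc
  apply h
  simp_rw [Finset.prod_univ_sum, Finset.sum_mul, Finset.mul_sum]
  rw [Finset.sum_comm]
  refine Finset.sum_eq_zero fun c hmem => ?_
  have := hc c fun i => Fintype.mem_piFinset.mp hmem i
  rw [← mul_zero (∏ i, a (c i)), ← this, Finset.mul_sum]
  refine Finset.sum_congr rfl fun z _ => ?_
  rw [Finset.prod_mul_distrib]
  ring

/-- The polynomial `P` is homogeneous of degree `q - p`. -/
theorem Pdef.sum_add_eq {F : Type} [Field F] {p q : ℕ} {hp : 0 < p} {P : MvPolynomial (Fin p) F}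
    (hP : Pdef p q hp P) {m : Fin p →₀ ℕ} (hm : m ∈ P.support) :
    ∑ l, m l + (p - 1) = q - 1 := by
  classical
  unfold Pdef at hP
  have hhom : (∑ I : Finset (Fin (p - 1)), MvPolynomial.C ((-1 : F) ^ (I.card + 1)) *
      ((∑ i ∈ I, MvPolynomial.X (Fin.castLE (Nat.sub_le p 1) i)) +
        MvPolynomial.X (⟨p - 1, Nat.sub_lt hp one_pos⟩ : Fin p)) ^ (q - 1)).IsHomogeneous
      (q - 1) := by
    refine MvPolynomial.IsHomogeneous.sum _ _ _ fun I _ => ?_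
    have hlin : ((∑ i ∈ I, MvPolynomial.X (Fin.castLE (Nat.sub_le p 1) i)) +
        MvPolynomial.X (⟨p - 1, Nat.sub_lt hp one_pos⟩ : Fin p) :
        MvPolynomial (Fin p) F).IsHomogeneous 1 :=
      (MvPolynomial.IsHomogeneous.sum _ _ _ fun i _ => MvPolynomial.isHomogeneous_X _ _).add
        (MvPolynomial.isHomogeneous_X _ _)
    simpa using (MvPolynomial.isHomogeneous_C (Fin p) ((-1 : F) ^ (I.card + 1))).mul
      (hlin.pow (q - 1))
  rw [← hP] at hhom
  have hmon : (∏ i : Fin (p - 1), MvPolynomial.X (Fin.castLE (Nat.sub_le p 1) i) :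
      MvPolynomial (Fin p) F) = MvPolynomial.monomial
        (∑ i : Fin (p - 1), Finsupp.single (Fin.castLE (Nat.sub_le p 1) i) 1) 1 := by
    rw [MvPolynomial.monomial_sum_one]
    rfl
  rw [hmon] at hhom
  have hcoeff := hhom (d := (∑ i : Fin (p - 1),
    Finsupp.single (Fin.castLE (Nat.sub_le p 1) i) 1) + m) (by
      rw [MvPolynomial.coeff_monomial_mul, one_mul]
      exact MvPolynomial.mem_support_iff.mp hm)
  have hdeg : Finsupp.weight (1 : Fin p → ℕ) = Finsupp.degree :=
    Finsupp.degree_eq_weight_one.symm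
  rw [hdeg, map_add, map_sum] at hcoeff
  simp only [Finsupp.degree_single, Finset.sum_const, Finset.card_univ, Fintype.card_fin,
    smul_eq_mul, mul_one] at hcoeff
  rw [Finsupp.degree_eq_sum] at hcoeff
  omega

/-- If `⟨x^{e'}, H_e⟩ ≠ 0` then every block of `e'` of length `p` sums to
`p(q - q/p)`, and `e'_{s+j} + e_j ∈ {q-1, 2(q-1)}` for every `j`. -/
theorem inner_product_with_H
    (p k : ℕ) (hp : p.Prime) (hk : 1 ≤ k)
    (F : Type) [Field F] [Fintype F]
    (q : ℕ) (hq : q = p ^ k) (hcard : Fintype.card F = q)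
    (d s r : ℕ) (hsp : p ∣ s) (hr0 : 0 < r) (hr1 : r ≤ p * (q - q / p))
    (hd : d + 1 = s * (q - q / p) + r)
    (t : ℕ) (ht : t = max (p + 2) 10)
    (P : MvPolynomial (Fin p) F) (hP : Pdef p q hp.pos P)
    (e : Fin t → ℕ) (he : ∀ j, e j ≤ q - 1)
    (e' : Fin (s + t) → ℕ) (he' : ∀ i, e' i ≤ q - 1)
    (hne : ip (fun x : Fin (s + t) → F => ∏ i, x i ^ e' i) (Hfun P s t e) ≠ 0) :
    (∀ i : ℕ, i < s / p →
      (∑ l : Fin p, if h : p * i + (l : ℕ) < s + t then e' ⟨p * i + (l : ℕ), h⟩ else 0) =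
        p * (q - q / p)) ∧
    (∀ j : Fin t, e' (Fin.natAdd s j) + e j = q - 1 ∨
      e' (Fin.natAdd s j) + e j = 2 * (q - 1)) := by
  obtain ⟨b, rfl⟩ : ∃ b, s = b * p := hsp.imp fun b hb => by rw [hb, mul_comm]
  have hb : b * p / p = b := Nat.mul_div_cancel b hp.pos
  rw [hb]
  have hlt (i : Fin b) (l : Fin p) : p * (i : ℕ) + l < b * p + t :=
    calc p * (i : ℕ) + l < p * i + p := by omega
      _ = (i + 1) * p := by ring
      _ ≤ b * p := Nat.mul_le_mul_right p i.2
      _ ≤ b * p + t := Nat.le_add_right _ _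
  have hne' : ∑ z : Fin (b * p + t) → F, (∏ i, z i ^ e' i) *
      ((∏ i : Fin b, ∑ m ∈ P.support, P.coeff m * ∏ l : Fin p, z ⟨p * i + l, hlt i l⟩ ^ m l) *
        ∏ j : Fin t, z (Fin.natAdd (b * p) j) ^ e j) ≠ 0 := by
    convert hne using 1
    unfold ip Hfun
    refine Finset.sum_congr rfl fun z _ => ?_
    rw [hb, Finset.prod_range]
    simp only [MvPolynomial.eval_eq', hlt, dite_true]
  obtain ⟨c, hc, hsum⟩ := exists_choice_sum_ne_zero P.support (fun m => P.coeff m)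
    (fun (i : Fin b) m (z : Fin (b * p + t) → F) => ∏ l : Fin p, z ⟨p * i + l, hlt i l⟩ ^ m l)
    (fun z => ∏ i, z i ^ e' i) (fun z => ∏ j : Fin t, z (Fin.natAdd (b * p) j) ^ e j) hne'
  let φ : (Fin b × Fin p) ⊕ Fin t ≃ Fin (b * p + t) :=
    (Equiv.sumCongr finProdFinEquiv (Equiv.refl _)).trans finSumFinEquiv
  have hφl (i : Fin b) (l : Fin p) : φ (Sum.inl (i, l)) = ⟨p * i + l, hlt i l⟩ := by
    ext
    simp [φ, add_comm]
  have hφr (j : Fin t) : φ (Sum.inr j) = Fin.natAdd (b * p) j := by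
    simp [φ]
  let E : Fin (b * p + t) → ℕ := fun k =>
    e' k + Sum.elim (fun il : Fin b × Fin p => c il.1 il.2) e (φ.symm k)
  have hE : ∑ z : Fin (b * p + t) → F, ∏ k, z k ^ E k ≠ 0 := by
    convert hsum using 1
    refine Finset.sum_congr rfl fun z _ => ?_
    simp only [E, pow_add, Finset.prod_mul_distrib]
    congr 1
    rw [← Equiv.prod_comp φ, Fintype.prod_sum_type, Fintype.prod_prod_type]
    simp only [Equiv.symm_apply_apply, Sum.elim_inl, Sum.elim_inr]
    simp only [hφl, hφr]
  have key := pos_and_card_sub_one_dvd_of_sum_prod_pow_ne_zero E hE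
  rw [hcard] at key
  have hpq : p ∣ q := hq ▸ dvd_pow_self p (by omega)
  have hq0 : 0 < q := hq ▸ pow_pos hp.pos k
  have hple : p ≤ q := Nat.le_of_dvd hq0 hpq
  have hp2 := hp.two_le
  refine ⟨fun i hi => ?_, fun j => ?_⟩
  · have hm := hP.sum_add_eq (hc ⟨i, hi⟩)
    have hexp (l : Fin p) : e' ⟨p * i + l, hlt ⟨i, hi⟩ l⟩ + c ⟨i, hi⟩ l = q - 1 := by
      have hk := key (φ (Sum.inl (⟨i, hi⟩, l)))
      simp only [E, Equiv.symm_apply_apply, Sum.elim_inl] at hk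
      rw [hφl] at hk
      dsimp only at hk
      obtain ⟨hpos, a, ha⟩ := hk
      have h1 := he' ⟨p * i + l, hlt ⟨i, hi⟩ l⟩
      have h2 : c ⟨i, hi⟩ l ≤ ∑ l, c ⟨i, hi⟩ l :=
        Finset.single_le_sum (fun _ _ => Nat.zero_le _) (Finset.mem_univ l)
      have ha2 : a < 2 := by
        by_contra! h
        have := Nat.mul_le_mul_left (q - 1) h
        omega
      interval_cases a <;> omega
    have htot := Finset.sum_congr (rfl : (Finset.univ : Finset (Fin p)) = _) fun l _ => hexp l
    rw [Finset.sum_add_distrib, Finset.sum_const, Finset.card_univ, Fintype.card_fin,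
      smul_eq_mul] at htot
    have hlt' (l : Fin p) : p * i + (l : ℕ) < b * p + t := hlt ⟨i, hi⟩ l
    simp only [hlt', dite_true]
    rw [Nat.mul_sub, Nat.mul_div_cancel' hpq]
    rw [Nat.mul_sub, mul_one] at htot
    have h3 : p * 2 ≤ p * q := Nat.mul_le_mul_left p (hp2.trans hple)
    have h4 : 2 * q ≤ p * q := Nat.mul_le_mul_right q hp2
    omega
  · have hk := key (φ (Sum.inr j))
    simp only [E, Equiv.symm_apply_apply, Sum.elim_inr] at hk
    rw [hφr] at hk
    obtain ⟨hpos, a, ha⟩ := hk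
    have h1 := he j
    have h2 := he' (Fin.natAdd (b * p) j)
    have ha3 : a < 3 := by
      by_contra! h
      have := Nat.mul_le_mul_left (q - 1) h
      omega
    interval_cases a <;> omega

end
end

section
/- Let n ≥ s + t + 110 and f : F_q^n → F_q, and let S_t ⊆ T_{n,s+t} be the set of affine maps that reject f. For every a ∈ F_q^{s+t} and b ∈ F_q^n such that the zoom-in on the linear part C_{a,b,lin} is nonempty, the density of S_t in C_{a,b,lin} is at most t·q^{162}·μ(S_t). -/
noncomputable section

open Finset

section PlaneIdentity

variable {F : Type} [Field F] [Fintype F]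

/-- If `H` vanishes on `x i = 0`, or sums to zero over all rescalings of its `i`-th variable, then
the test of `G · 0` against `H` is determined by the tests on affine subspaces of `F^ℓ × F` which
are transversal to the `i`-th coordinate direction. -/
theorem sum_mul_eq_zero_of_transversal {ℓ : ℕ} (i : Fin ℓ) (H : (Fin ℓ → F) → F)
    (G : (Fin ℓ → F) → F → F)
    (hH : (∀ x, H (Function.update x i 0) = 0) ∨
      ∀ x, ∑ c : F, H (Function.update x i (c * x i)) = 0)
    (hgraph : ∀ (γ : Fˣ) (x₀ : F), ∑ x, G x (γ * (x i - x₀)) * H x = 0)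
    (hvert : ∀ c : Fˣ, ∑ x, G (Function.update x i 0) ((c : F)⁻¹ * x i) * H x = 0) :
    ∑ x, G x 0 * H x = 0 := by
  classical
  have htotal : ∑ x, ∑ z, G x z * H x = 0 := by
    have h : ∑ x₀ : F, ∑ x, G x (x i - x₀) * H x = 0 :=
      Finset.sum_eq_zero fun x₀ _ => by simpa using hgraph 1 x₀
    rw [Finset.sum_comm] at h
    rw [← h]
    refine Finset.sum_congr rfl fun x _ => ?_
    exact (Equiv.sum_comp (Equiv.subLeft (x i)) fun z => G x z * H x).symm
  have hpencil : ∑ x, G x 0 * H x = ∑ x, if x i = 0 then 0 else ∑ z, G x z * H x := by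
    have h : ∑ γ : F, ∑ x, G x (γ * x i) * H x = ∑ x, G x 0 * H x := by
      rw [Finset.sum_eq_single (0 : F)]
      · simp
      · intro γ _ hγ
        simpa using hgraph (Units.mk0 γ hγ) 0
      · simp
    rw [← h, Finset.sum_comm]
    refine Finset.sum_congr rfl fun x _ => ?_
    split_ifs with hx
    · simp [hx]
    · exact Equiv.sum_comp (Equiv.mulRight₀ (x i) hx) fun z => G x z * H x
  have hsplit : ∑ x, G x 0 * H x = - ∑ x, if x i = 0 then ∑ z, G x z * H x else 0 := by
    rw [hpencil, eq_neg_iff_add_eq_zero, ← Finset.sum_add_distrib]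
    refine Eq.trans ?_ htotal
    refine Finset.sum_congr rfl fun x _ => ?_
    split_ifs <;> simp
  rw [hsplit, neg_eq_zero]
  rcases hH with hH | hH
  · refine Finset.sum_eq_zero fun x _ => ?_
    split_ifs with hx
    · have : H x = 0 := by
        rw [← hH x, Function.update_eq_self_iff.mpr hx.symm]
      simp [this]
    · rfl
  · have hslice : (∑ x, if x i = 0 then ∑ z, G x z * H x else 0) =
        ∑ x, G (Function.update x i 0) (x i) * H (Function.update x i 0) := by
      rw [← Finset.sum_filter, Finset.sum_sigma']
      refine Finset.sum_nbij' (fun y => Function.update y.1 i y.2)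
        (fun x => ⟨Function.update x i 0, x i⟩) ?_ ?_ ?_ ?_ ?_
      · simp
      · simp
      · rintro ⟨y, z⟩ hy
        have hy : y i = 0 := by simpa using hy
        simp [← hy]
      · simp
      · rintro ⟨y, z⟩ hy
        have hy : y i = 0 := by simpa using hy
        simp [← hy]
    rw [hslice]
    have hscale : ∀ c : F, c ≠ 0 →
        ∑ x, G (Function.update x i 0) (x i) * H (Function.update x i (c * x i)) = 0 := by
      intro c hc
      refine Eq.trans ?_ (hvert (Units.mk0 c hc))
      refine Finset.sum_nbij' (fun x => Function.update x i (c * x i))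
        (fun x => Function.update x i (c⁻¹ * x i)) ?_ ?_ ?_ ?_ ?_ <;> simp [hc]
    calc _ = ∑ c : F, ∑ x,
          G (Function.update x i 0) (x i) * H (Function.update x i (c * x i)) := by
            rw [Finset.sum_eq_single (0 : F)]
            · simp
            · exact fun c _ hc => hscale c hc
            · simp
      _ = 0 := by
        rw [Finset.sum_comm]
        exact Finset.sum_eq_zero fun x _ => by rw [← Finset.mul_sum, hH, mul_zero]

end PlaneIdentity

section TestPolynomials

variable {F : Type} [Field F]

theorem Pdef.totalDegree_lt {p q : ℕ} (hp : p.Prime) (hq : 2 ≤ q) {P : MvPolynomial (Fin p) F}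
    (hP : Pdef p q hp.pos P) : P.totalDegree < q - 1 := by
  rcases eq_or_ne P 0 with rfl | hP0
  · simp
    omega
  have hp2 := hp.two_le
  have hX : (∏ i : Fin (p - 1), (MvPolynomial.X (Fin.castLE (Nat.sub_le p 1) i) :
      MvPolynomial (Fin p) F)) ≠ 0 :=
    Finset.prod_ne_zero_iff.mpr fun i _ => MvPolynomial.X_ne_zero _
  have hdeg := congrArg MvPolynomial.totalDegree hP
  rw [MvPolynomial.totalDegree_mul_of_isDomain hX hP0,
    (MvPolynomial.IsHomogeneous.prod _ _ (fun _ => 1)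
      fun i _ => MvPolynomial.isHomogeneous_X F _).totalDegree hX] at hdeg
  simp only [Finset.sum_const, Finset.card_univ, Fintype.card_fin, smul_eq_mul, mul_one] at hdeg
  have hle : (∑ I : Finset (Fin (p - 1)),
      MvPolynomial.C ((-1 : F) ^ (I.card + 1)) *
        ((∑ i ∈ I, MvPolynomial.X (Fin.castLE (Nat.sub_le p 1) i)) +
          MvPolynomial.X (⟨p - 1, Nat.sub_lt hp.pos one_pos⟩ : Fin p)) ^ (q - 1)).totalDegree
      ≤ q - 1 := by
    refine MvPolynomial.totalDegree_finsetSum_le fun I _ => ?_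
    refine (MvPolynomial.totalDegree_mul _ _).trans ?_
    rw [MvPolynomial.totalDegree_C, zero_add]
    refine (MvPolynomial.totalDegree_pow _ _).trans ?_
    have hlin : ((∑ i ∈ I, (MvPolynomial.X (Fin.castLE (Nat.sub_le p 1) i) :
        MvPolynomial (Fin p) F)) +
          MvPolynomial.X (⟨p - 1, Nat.sub_lt hp.pos one_pos⟩ : Fin p)).totalDegree ≤ 1 := by
      refine (MvPolynomial.totalDegree_add _ _).trans (max_le ?_ ?_)
      · exact MvPolynomial.totalDegree_finsetSum_le fun i _ => by simp
      · simp
    calc _ ≤ (q - 1) * 1 := Nat.mul_le_mul_left _ hlin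
      _ = q - 1 := mul_one _
  omega

theorem sum_eval_update_mul_eq_zero [Fintype F] {σ : Type} [Fintype σ] [DecidableEq σ]
    {P : MvPolynomial σ F} (hP : P.totalDegree < Fintype.card F - 1) (l : σ) (x : σ → F) :
    ∑ c : F, MvPolynomial.eval (Function.update x l (c * x l)) P = 0 := by
  simp only [MvPolynomial.eval_eq']
  rw [Finset.sum_comm]
  refine Finset.sum_eq_zero fun m hm => ?_
  have hterm : ∀ c : F, P.coeff m * ∏ j, Function.update x l (c * x l) j ^ m j =
      c ^ m l * (P.coeff m * ∏ j, x j ^ m j) := by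
    intro c
    rw [← Finset.mul_prod_erase _ _ (Finset.mem_univ l),
      ← Finset.mul_prod_erase _ (fun j => x j ^ m j) (Finset.mem_univ l),
      Finset.prod_congr rfl (g := fun j => x j ^ m j) fun j hj => by
        rw [Function.update_of_ne (Finset.ne_of_mem_erase hj)]]
    simp only [Function.update_self, mul_pow]
    ring
  rw [Finset.sum_congr rfl fun c _ => hterm c, ← Finset.sum_mul,
    FiniteField.sum_pow_lt_card_sub_one, zero_mul]
  have h1 : m l ≤ m.degree := Finsupp.le_degree l m
  have h2 := MvPolynomial.le_totalDegree hm
  exact lt_of_le_of_lt (h1.trans h2) hP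

theorem Hfun_update_vanishes_or_sum_eq_zero [Fintype F] {p : ℕ} {P : MvPolynomial (Fin p) F}
    (hP : P.totalDegree < Fintype.card F - 1) {s : ℕ} (hsp : p ∣ s) (t : ℕ) (e : Fin t → ℕ)
    (i : Fin (s + t)) :
    (∀ x, Hfun P s t e (Function.update x i 0) = 0) ∨
      ∀ x, ∑ c : F, Hfun P s t e (Function.update x i (c * x i)) = 0 := by
  induction i using Fin.addCases with
  | left i =>
    right
    intro x
    have hp0 : 0 < p := by
      rcases Nat.eq_zero_or_pos p with rfl | h
      · have := i.2
        have := Nat.eq_zero_of_zero_dvd hsp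
        omega
      · exact h
    have hblock : (i : ℕ) / p < s / p := Nat.div_lt_div_of_lt_of_dvd hsp i.2
    set l : Fin p := ⟨(i : ℕ) % p, Nat.mod_lt _ hp0⟩
    have hi : p * ((i : ℕ) / p) + (l : ℕ) = i := Nat.div_add_mod _ _
    set y : Fin p → F := fun l =>
      if h : p * ((i : ℕ) / p) + (l : ℕ) < s + t then x ⟨p * ((i : ℕ) / p) + (l : ℕ), h⟩ else 0
      with hy
    have hyl : y l = x (Fin.castAdd t i) := by
      have : p * ((i : ℕ) / p) + (l : ℕ) < s + t := by omega
      simp only [hy, this, dif_pos]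
      congr 1
      exact Fin.ext hi
    have hfactor : ∀ c : F,
        Hfun P s t e (Function.update x (Fin.castAdd t i) (c * x (Fin.castAdd t i))) =
        MvPolynomial.eval (Function.update y l (c * y l)) P *
          ((∏ j ∈ (Finset.range (s / p)).erase ((i : ℕ) / p),
            MvPolynomial.eval (fun l : Fin p =>
              if h : p * j + (l : ℕ) < s + t then x ⟨p * j + (l : ℕ), h⟩ else 0) P) *
          ∏ j : Fin t, x (Fin.natAdd s j) ^ e j) := by
      intro c
      rw [Hfun, ← Finset.mul_prod_erase _ _ (Finset.mem_range.mpr hblock), mul_assoc]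
      congr 1
      · congr 2
        funext m
        rcases eq_or_ne m l with rfl | hm
        · have h : p * ((i : ℕ) / p) + (l : ℕ) < s + t := by omega
          have h' : (⟨p * ((i : ℕ) / p) + (l : ℕ), h⟩ : Fin (s + t)) = Fin.castAdd t i :=
            Fin.ext hi
          rw [dif_pos h, h', Function.update_self, Function.update_self, hyl]
        · rw [Function.update_of_ne hm]
          simp only [hy]
          split_ifs with h
          · refine Function.update_of_ne (fun h' => hm (Fin.ext ?_)) _ _
            have := congrArg Fin.val h'
            simp only [Fin.val_castAdd] at this
            omega
          · rfl
      · congr 1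
        · refine Finset.prod_congr rfl fun j hj => ?_
          congr 2
          funext m
          split_ifs with h
          · refine Function.update_of_ne (fun h' => Finset.ne_of_mem_erase hj ?_) _ _
            have h' := congrArg Fin.val h'
            simp only [Fin.val_castAdd] at h'
            rw [← h', Nat.mul_add_div hp0, Nat.div_eq_of_lt m.2, add_zero]
          · rfl
        · refine Finset.prod_congr rfl fun j _ => ?_
          rw [Function.update_of_ne]
          intro h'
          have := congrArg Fin.val h'
          simp only [Fin.val_castAdd, Fin.val_natAdd] at this
          omega
    rw [Finset.sum_congr rfl fun c _ => hfactor c, ← Finset.sum_mul,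
      sum_eval_update_mul_eq_zero hP, zero_mul]
  | right j =>
    rcases Nat.eq_zero_or_pos (e j) with he | he
    · right
      intro x
      have hconst : ∀ c : F,
          Hfun P s t e (Function.update x (Fin.natAdd s j) (c * x (Fin.natAdd s j))) =
          Hfun P s t e x := by
        intro c
        unfold Hfun
        congr 1
        · refine Finset.prod_congr rfl fun k hk => ?_
          congr 2
          funext m
          split_ifs with h
          · refine Function.update_of_ne (fun h' => ?_) _ _
            have h' := congrArg Fin.val h'
            simp only [Fin.val_natAdd] at h'
            have h1 : p * (k + 1) ≤ p * (s / p) :=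
              Nat.mul_le_mul_left _ (Finset.mem_range.mp hk)
            have h2 := Nat.mul_div_le s p
            have h3 := m.2
            rw [mul_add, mul_one] at h1
            omega
          · rfl
        · refine Finset.prod_congr rfl fun k _ => ?_
          rcases eq_or_ne k j with rfl | hk
          · simp [he]
          · rw [Function.update_of_ne]
            exact fun h => hk (Fin.natAdd_injective t s h)
      simp [hconst]
    · left
      intro x
      refine mul_eq_zero_of_right _ (Finset.prod_eq_zero (Finset.mem_univ j) ?_)
      simp [he.ne']

end TestPolynomials

section Perturbation

variable {F : Type} [Field F] {n ℓ : ℕ}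

/-- Perturbations of the affine map `T` in the direction `u` that affect the `i`-th variable `xᵢ`:
either add `γ (xᵢ - x₀) u` to `T x`, or replace the `i`-th column of `T` by `c⁻¹ u`. -/
def perturb (i : Fin ℓ) (T : Aff F n ℓ) (u : Fin n → F) : (Fˣ × F) ⊕ Fˣ → Aff F n ℓ
  | .inl (γ, x₀) => (T.1 + Matrix.vecMulVec u (Pi.single i (γ : F)), T.2 - ((γ : F) * x₀) • u)
  | .inr c => (T.1.updateCol i ((c : F)⁻¹ • u), T.2)

theorem vecMulVec_single_mulVec (u : Fin n → F) (i : Fin ℓ) (γ : F) (x : Fin ℓ → F) :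
    (Matrix.vecMulVec u (Pi.single i γ)).mulVec x = (γ * x i) • u := by
  rw [Matrix.vecMulVec_mulVec, single_dotProduct]
  ext k
  simp [mul_comm]

theorem updateCol_mulVec (M : Matrix (Fin n) (Fin ℓ) F) (i : Fin ℓ) (v : Fin n → F)
    (x : Fin ℓ → F) :
    (M.updateCol i v).mulVec x = M.mulVec (Function.update x i 0) + x i • v := by
  ext k
  simp only [Matrix.mulVec, dotProduct, Pi.add_apply, Pi.smul_apply, smul_eq_mul]
  rw [← Finset.add_sum_erase _ _ (Finset.mem_univ i),
    ← Finset.add_sum_erase _ (fun j => M k j * _) (Finset.mem_univ i),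
    Finset.sum_congr rfl (g := fun j => M k j * Function.update x i 0 j) fun j hj => by
      rw [Matrix.updateCol_ne (Finset.ne_of_mem_erase hj),
        Function.update_of_ne (Finset.ne_of_mem_erase hj)]]
  simp
  ring

theorem affApp_perturb_inl (i : Fin ℓ) (T : Aff F n ℓ) (u : Fin n → F) (γ : Fˣ) (x₀ : F)
    (x : Fin ℓ → F) :
    affApp (perturb i T u (.inl (γ, x₀))) x = affApp T x + ((γ : F) * (x i - x₀)) • u := by
  simp only [affApp, perturb, Matrix.add_mulVec, vecMulVec_single_mulVec]
  module

theorem affApp_perturb_inr (i : Fin ℓ) (T : Aff F n ℓ) (u : Fin n → F) (c : Fˣ)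
    (x : Fin ℓ → F) :
    affApp (perturb i T u (.inr c)) x =
      affApp T (Function.update x i 0) + ((c : F)⁻¹ * x i) • u := by
  simp only [affApp, perturb, updateCol_mulVec]
  module

/-- On a zoom-in `M a = b` with `a i ≠ 0`, the perturbed map determines the original map and the
direction. -/
theorem perturb_injOn {i : Fin ℓ} {a : Fin ℓ → F} (ha : a i ≠ 0) {b : Fin n → F}
    (κ : (Fˣ × F) ⊕ Fˣ) {T T' : Aff F n ℓ} (hT : T.1.mulVec a = b) (hT' : T'.1.mulVec a = b)
    {u u' : Fin n → F} (h : perturb i T u κ = perturb i T' u' κ) : T = T' ∧ u = u' := by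
  obtain ⟨M, v⟩ := T
  obtain ⟨M', v'⟩ := T'
  simp only at hT hT'
  rcases κ with ⟨γ, x₀⟩ | c
  · simp only [perturb, Prod.mk.injEq] at h
    have hu : u = u' := by
      have := congrArg (fun N => Matrix.mulVec N a) h.1
      simp only [Matrix.add_mulVec, vecMulVec_single_mulVec, hT, hT', add_right_inj] at this
      exact smul_right_injective _ (mul_ne_zero γ.ne_zero ha) this
    subst hu
    simpa using h
  · simp only [perturb, Prod.mk.injEq] at h
    obtain ⟨h, rfl⟩ := h
    have hcol : ∀ k, (c : F)⁻¹ * u k = (c : F)⁻¹ * u' k := fun k => by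
      simpa using congrFun (congrFun h k) i
    have hne : ∀ k j, j ≠ i → M k j = M' k j := fun k j hj => by
      simpa [hj] using congrFun (congrFun h k) j
    have hu : u = u' := funext fun k => mul_left_cancel₀ (inv_ne_zero c.ne_zero) (hcol k)
    refine ⟨Prod.ext ?_ rfl, hu⟩
    ext k j
    rcases eq_or_ne j i with rfl | hj
    · have hk := congrFun (hT.trans hT'.symm) k
      simp only [Matrix.mulVec, dotProduct] at hk
      rw [← Finset.add_sum_erase _ _ (Finset.mem_univ j),
        ← Finset.add_sum_erase _ (fun m => M' k m * a m) (Finset.mem_univ j),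
        Finset.sum_congr rfl (g := fun m => M' k m * a m) fun m hm => by
          rw [hne k m (Finset.ne_of_mem_erase hm)]] at hk
      exact mul_right_cancel₀ ha (add_right_cancel hk)
    · exact hne k j hj

theorem card_aff_le_card_zoomIn_mul [Fintype F] {i : Fin ℓ} {a : Fin ℓ → F} (ha : a i ≠ 0)
    (b : Fin n → F) :
    Nat.card (Aff F n ℓ) ≤
      Nat.card {T : Aff F n ℓ | T.1.mulVec a = b} * Nat.card (Fin n → F) := by
  rw [← Nat.card_prod]
  refine Nat.card_le_card_of_injective (fun T : Aff F n ℓ =>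
    (⟨(T.1 - Matrix.vecMulVec (T.1.mulVec a - b) (Pi.single i (a i)⁻¹), T.2), ?_⟩,
      T.1.mulVec a - b)) ?_
  · simp [Matrix.sub_mulVec, vecMulVec_single_mulVec, ha]
  · rintro ⟨M, v⟩ ⟨M', v'⟩ h
    simp only [Prod.mk.injEq, Subtype.mk.injEq] at h
    obtain ⟨⟨h1, h2⟩, h3⟩ := h
    rw [h3, sub_left_inj] at h1
    exact Prod.ext h1 h2

theorem exists_rejects_perturb [Fintype F] {p : ℕ} {P : MvPolynomial (Fin p) F}
    (hP : P.totalDegree < Fintype.card F - 1) {s : ℕ} (hsp : p ∣ s) {q r t : ℕ}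
    {f : (Fin n → F) → F} {T : Aff F n (s + t)} (hT : rejects P q s r t n f T)
    (i : Fin (s + t)) (u : Fin n → F) :
    ∃ κ, rejects P q s r t n f (perturb i T u κ) := by
  by_contra! hcon
  obtain ⟨e, he, hne⟩ := hT
  have hzero : ∀ κ, ip (fun x => f (affApp (perturb i T u κ) x)) (Hfun P s t e) = 0 :=
    fun κ => not_not.mp fun h => hcon κ ⟨e, he, h⟩
  refine hne ?_
  have := sum_mul_eq_zero_of_transversal i (Hfun P s t e) (fun x y => f (affApp T x + y • u))
    (Hfun_update_vanishes_or_sum_eq_zero hP hsp t e i)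
    (fun γ x₀ => by simpa only [ip, affApp_perturb_inl] using hzero (.inl (γ, x₀)))
    (fun c => by simpa only [ip, affApp_perturb_inr] using hzero (.inr c))
  simpa [ip] using this

/-- A set `S` such that every perturbation of a member in every direction can be completed to a
member of `S` has density at most `|F|²` times its measure in a zoom-in on the linear part. -/
theorem dens_zoomIn_le_of_perturb [Fintype F] {i : Fin ℓ} {a : Fin ℓ → F} (ha : a i ≠ 0)
    (b : Fin n → F) (S : Set (Aff F n ℓ)) (hS : ∀ T ∈ S, ∀ u, ∃ κ, perturb i T u κ ∈ S) :
    dens S {T : Aff F n ℓ | T.1.mulVec a = b} ≤ (Fintype.card F : ℝ) ^ 2 * mu S := by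
  set C := {T : Aff F n ℓ | T.1.mulVec a = b}
  have hcount : Nat.card ↥(S ∩ C) * Nat.card (Fin n → F) ≤ Fintype.card F ^ 2 * Nat.card S := by
    have hindex : Nat.card ((Fˣ × F) ⊕ Fˣ) ≤ Fintype.card F ^ 2 := by
      classical
      rw [Nat.card_sum, Nat.card_prod, Nat.card_eq_fintype_card, Nat.card_eq_fintype_card,
        Fintype.card_units]
      obtain ⟨m, hm⟩ := Nat.exists_eq_add_of_lt (Fintype.card_pos (α := F))
      rw [hm]
      simp only [zero_add, Nat.add_sub_cancel]
      nlinarith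
    choose κ hκ using hS
    refine le_trans ?_ (Nat.mul_le_mul_right _ hindex)
    rw [← Nat.card_prod, ← Nat.card_prod]
    refine Nat.card_le_card_of_injective
      (fun y : ↥(S ∩ C) × (Fin n → F) => (κ y.1.1 y.1.2.1 y.2, ⟨_, hκ y.1.1 y.1.2.1 y.2⟩)) ?_
    rintro ⟨⟨T, hT⟩, u⟩ ⟨⟨T', hT'⟩, u'⟩ h
    simp only [Prod.mk.injEq, Subtype.mk.injEq] at h
    obtain ⟨h1, h2⟩ := h
    rw [h1] at h2
    obtain ⟨rfl, rfl⟩ := perturb_injOn ha _ hT.2 hT'.2 h2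
    rfl
  have hcard := card_aff_le_card_zoomIn_mul ha b
  have hAff : 0 < Nat.card (Aff F n ℓ) := Nat.card_pos
  have hC : 0 < Nat.card C := Nat.pos_of_ne_zero fun h => by
    rw [h, zero_mul] at hcard
    omega
  rw [_root_.dens, mu, ← mul_div_assoc, div_le_div_iff₀ (by exact_mod_cast hC) (by exact_mod_cast hAff)]
  have : Nat.card ↥(S ∩ C) * Nat.card (Aff F n ℓ) ≤
      Fintype.card F ^ 2 * Nat.card S * Nat.card C :=
    calc _ ≤ Nat.card ↥(S ∩ C) * (Nat.card C * Nat.card (Fin n → F)) :=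
          Nat.mul_le_mul_left _ hcard
      _ = Nat.card ↥(S ∩ C) * Nat.card (Fin n → F) * Nat.card C := by ring
      _ ≤ _ := Nat.mul_le_mul_right _ hcount
  exact_mod_cast this

end Perturbation

/-- The rejecting set `S_t` is `t·q^{162}·μ(S_t)`-pseudorandom with respect
to zoom-ins on the linear part. -/
theorem rejecting_set_pseudorandom_zoom_in_linear
    (p k : ℕ) (hp : p.Prime) (hk : 1 ≤ k)
    (F : Type) [Field F] [Fintype F]
    (q : ℕ) (hq : q = p ^ k) (hcard : Fintype.card F = q)
    (d s r : ℕ) (hsp : p ∣ s) (hr0 : 0 < r) (hr1 : r ≤ p * (q - q / p))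
    (hd : d + 1 = s * (q - q / p) + r)
    (t : ℕ) (ht : t = max (p + 2) 10)
    (P : MvPolynomial (Fin p) F) (hP : Pdef p q hp.pos P)
    (n : ℕ) (hn : s + t + 110 ≤ n) (f : (Fin n → F) → F)
    (a : Fin (s + t) → F) (b : Fin n → F)
    (hne : {T : Aff F n (s + t) | T.1.mulVec a = b}.Nonempty) :
    dens {T : Aff F n (s + t) | rejects P q s r t n f T}
        {T : Aff F n (s + t) | T.1.mulVec a = b} ≤
      (t : ℝ) * (q : ℝ) ^ 162 * mu {T : Aff F n (s + t) | rejects P q s r t n f T} := by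
  have hq2 : 2 ≤ q := by
    rw [← hcard]
    exact Fintype.one_lt_card
  have ht1 : (1 : ℝ) ≤ t := by
    have : 1 ≤ t := ht ▸ (by omega : 1 ≤ 10).trans (le_max_right _ _)
    exact_mod_cast this
  have hq1 : (1 : ℝ) ≤ q := by exact_mod_cast (by omega : 1 ≤ q)
  set S := {T : Aff F n (s + t) | rejects P q s r t n f T}
  have hmu : 0 ≤ mu S := by unfold mu; positivity
  suffices h : dens S {T : Aff F n (s + t) | T.1.mulVec a = b} ≤ (q : ℝ) ^ 2 * mu S by
    refine h.trans (mul_le_mul_of_nonneg_right ?_ hmu)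
    calc (q : ℝ) ^ 2 ≤ (q : ℝ) ^ 162 := pow_le_pow_right₀ hq1 (by norm_num)
      _ ≤ t * (q : ℝ) ^ 162 := le_mul_of_one_le_left (by positivity) ht1
  rcases eq_or_ne a 0 with rfl | ha
  · obtain ⟨T, hT⟩ := hne
    have hb : b = 0 := by simpa [eq_comm] using hT
    have hdens : dens S {T : Aff F n (s + t) | T.1.mulVec 0 = b} = mu S := by
      simp [_root_.dens, mu, hb]
    rw [hdens]
    exact le_mul_of_one_le_left hmu (one_le_pow₀ hq1)
  · obtain ⟨i, hi⟩ := Function.ne_iff.mp ha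
    rw [← hcard]
    exact dens_zoomIn_le_of_perturb hi b S fun T hT u =>
      exists_rejects_perturb (hcard.symm ▸ hP.totalDegree_lt hp hq2) hsp hT i u

end
end
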